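/- arXiv:1811.01696 — 2 statements merged into one kernel-verified Lean document; each statement's English description precedes it below -/
import Mathlib

section
/- Let F be a homogeneous polynomial of degree d in ℝ[w_0, w_1, …, w_n] with nonnegative coefficients, and let w ∈ ℝ^{n+1} have all coordinates strictly positive. Suppose that for each i = 0, 1, …, n, the Hessian matrix of ∂F/∂w_i evaluated at w has exactly one positive eigenvalue (counted with multiplicity). Then the kernel of the Hessian of F at w equals the intersection over i = 0, …, n of the kernels of the Hessians of ∂F/∂w_i at w. -/
open MvPolynomial Matrix

/-- The Hessian matrix of a polynomial at a point. -/
noncomputable def hessian {N : ℕ} (F : MvPolynomial (Fin N) ℝ) (w : Fin N → ℝ) :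
    Matrix (Fin N) (Fin N) ℝ :=
  Matrix.of fun i j => eval w (pderiv i (pderiv j F))

section QuadraticForm

variable {ι : Type*} [Fintype ι] {A : Matrix ι ι ℝ}

/-- The spectral expansion of the quadratic form of a real symmetric matrix. -/
lemma Matrix.IsHermitian.dotProduct_mulVec_eq_sum_eigenvalues [DecidableEq ι]
    (hA : A.IsHermitian) (x : ι → ℝ) :
    x ⬝ᵥ A *ᵥ x = ∑ j, hA.eigenvalues j * (x ⬝ᵥ ⇑(hA.eigenvectorBasis j)) ^ 2 := by
  have h := hA.eigenvectorBasis.sum_inner_mul_inner (WithLp.toLp 2 x) (WithLp.toLp 2 (A *ᵥ x))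
  simp only [EuclideanSpace.inner_eq_star_dotProduct, star_trivial] at h
  rw [dotProduct_comm, ← h]
  refine Finset.sum_congr rfl fun j _ => ?_
  have hj : A *ᵥ x ⬝ᵥ ⇑(hA.eigenvectorBasis j)
      = hA.eigenvalues j * (x ⬝ᵥ ⇑(hA.eigenvectorBasis j)) := by
    have hT : Aᵀ = A := by simpa using hA.eq
    rw [dotProduct_comm, dotProduct_mulVec, ← mulVec_transpose, hT, hA.mulVec_eigenvectorBasis,
      smul_dotProduct, smul_eq_mul, dotProduct_comm]
  rw [hj, dotProduct_comm _ x]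
  ring

/-- A real symmetric matrix with a single positive eigenvalue is negative semidefinite on some
hyperplane. -/
lemma Matrix.IsHermitian.exists_dotProduct_mulVec_nonpos [DecidableEq ι] (hA : A.IsHermitian)
    (h : Fintype.card {j // 0 < hA.eigenvalues j} = 1) :
    ∃ v : ι → ℝ, ∀ x, x ⬝ᵥ v = 0 → x ⬝ᵥ A *ᵥ x ≤ 0 := by
  obtain ⟨⟨k, hk⟩, hk'⟩ := Fintype.card_eq_one_iff.mp h
  refine ⟨⇑(hA.eigenvectorBasis k), fun x hx => ?_⟩
  rw [hA.dotProduct_mulVec_eq_sum_eigenvalues]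
  refine Finset.sum_nonpos fun j _ => ?_
  by_cases hj : 0 < hA.eigenvalues j
  · obtain rfl : j = k := congrArg Subtype.val (hk' ⟨j, hj⟩)
    simp [hx]
  · exact mul_nonpos_of_nonpos_of_nonneg (not_lt.mp hj) (sq_nonneg _)

lemma Matrix.IsSymm.dotProduct_mulVec_comm (hA : A.IsSymm) (x y : ι → ℝ) :
    x ⬝ᵥ A *ᵥ y = y ⬝ᵥ A *ᵥ x := by
  rw [dotProduct_mulVec, ← mulVec_transpose, hA.eq, dotProduct_comm]

/-- The reverse Cauchy–Schwarz inequality for a form that is negative semidefinite on a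
hyperplane. -/
lemma Matrix.IsSymm.dotProduct_mulVec_nonpos (hA : A.IsSymm) {v w z : ι → ℝ}
    (hv : ∀ x, x ⬝ᵥ v = 0 → x ⬝ᵥ A *ᵥ x ≤ 0) (hw : 0 < w ⬝ᵥ A *ᵥ w)
    (hz : w ⬝ᵥ A *ᵥ z = 0) : z ⬝ᵥ A *ᵥ z ≤ 0 := by
  have hwv : w ⬝ᵥ v ≠ 0 := fun h => (hv w h).not_gt hw
  have h := hv ((w ⬝ᵥ v) • z - (z ⬝ᵥ v) • w) (by
    simp only [sub_dotProduct, smul_dotProduct, smul_eq_mul]; ring)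
  simp only [sub_dotProduct, smul_dotProduct, smul_eq_mul, mulVec_sub, mulVec_smul,
    dotProduct_sub, dotProduct_smul, hz, hA.dotProduct_mulVec_comm z w] at h
  have hpos : 0 < (w ⬝ᵥ v) ^ 2 := by positivity
  have := mul_nonneg (sq_nonneg (z ⬝ᵥ v)) hw.le
  by_contra! hc
  have := mul_pos hpos hc
  nlinarith

/-- The equality case of the reverse Cauchy–Schwarz inequality. -/
lemma Matrix.IsSymm.mulVec_eq_zero_of_dotProduct_mulVec_eq_zero (hA : A.IsSymm)
    {v w z : ι → ℝ} (hv : ∀ x, x ⬝ᵥ v = 0 → x ⬝ᵥ A *ᵥ x ≤ 0) (hw : 0 < w ⬝ᵥ A *ᵥ w)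
    (hz : w ⬝ᵥ A *ᵥ z = 0) (hzz : z ⬝ᵥ A *ᵥ z = 0) : A *ᵥ z = 0 := by
  have key : ∀ y, w ⬝ᵥ A *ᵥ y = 0 → y ⬝ᵥ A *ᵥ z = 0 := by
    intro y hy
    have hq : ∀ t : ℝ, 2 * t * (y ⬝ᵥ A *ᵥ z) + t ^ 2 * (y ⬝ᵥ A *ᵥ y) ≤ 0 := by
      intro t
      have h := hA.dotProduct_mulVec_nonpos hv hw (z := z + t • y) (by
        simp [mulVec_add, mulVec_smul, hz, hy])
      simp only [add_dotProduct, smul_dotProduct, smul_eq_mul, mulVec_add, mulVec_smul,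
        dotProduct_add, dotProduct_smul, hzz, hA.dotProduct_mulVec_comm z y] at h
      linarith
    have hd := discrim_le_zero_of_nonpos (a := y ⬝ᵥ A *ᵥ y) (b := 2 * (y ⬝ᵥ A *ᵥ z)) (c := 0)
      fun t => by linarith [hq t]
    simp only [discrim] at hd
    nlinarith [sq_nonneg (y ⬝ᵥ A *ᵥ z)]
  have hall : ∀ u, u ⬝ᵥ A *ᵥ z = 0 := by
    intro u
    have h := key (u - ((w ⬝ᵥ A *ᵥ u) / (w ⬝ᵥ A *ᵥ w)) • w) (by
      simp only [mulVec_sub, mulVec_smul, dotProduct_sub, dotProduct_smul, smul_eq_mul]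
      field_simp
      ring)
    simpa [sub_dotProduct, smul_dotProduct, hz] using h
  exact dotProduct_self_eq_zero.mp (hall _)

end QuadraticForm

section Derivatives

variable {σ : Type*}

lemma MvPolynomial.pderiv_pderiv_comm {R : Type*} [CommSemiring R] (i j : σ)
    (p : MvPolynomial σ R) : pderiv i (pderiv j p) = pderiv j (pderiv i p) := by
  classical
  ext m
  by_cases h : i = j
  · rw [h]
  · simp only [coeff_pderiv, Finsupp.add_apply, Finsupp.single_eq_of_ne h,
      Finsupp.single_eq_of_ne (Ne.symm h), add_zero]
    rw [add_right_comm]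
    ring

lemma MvPolynomial.coeff_pderiv_nonneg {p : MvPolynomial σ ℝ} (hp : ∀ m, 0 ≤ p.coeff m) (i : σ)
    (m : σ →₀ ℕ) : 0 ≤ (pderiv i p).coeff m := by
  rw [coeff_pderiv]
  exact mul_nonneg (hp _) (by positivity)

lemma MvPolynomial.eval_nonneg_of_coeff_nonneg {p : MvPolynomial σ ℝ} (hp : ∀ m, 0 ≤ p.coeff m)
    {w : σ → ℝ} (hw : ∀ i, 0 ≤ w i) : 0 ≤ eval w p := by
  rw [eval_eq]
  exact Finset.sum_nonneg fun m _ =>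
    mul_nonneg (hp m) (Finset.prod_nonneg fun i _ => pow_nonneg (hw i) _)

end Derivatives

section Hessian

variable {N : ℕ}

lemma hessian_apply (F : MvPolynomial (Fin N) ℝ) (w : Fin N → ℝ) (i j : Fin N) :
    hessian F w i j = eval w (pderiv i (pderiv j F)) := rfl

lemma hessian_isSymm (F : MvPolynomial (Fin N) ℝ) (w : Fin N → ℝ) : (hessian F w).IsSymm := by
  ext i j
  simp only [transpose_apply, hessian_apply]
  rw [pderiv_pderiv_comm]

lemma hessian_pderiv_apply_comm (F : MvPolynomial (Fin N) ℝ) (w : Fin N → ℝ) (i j k : Fin N) :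
    hessian (pderiv i F) w j k = hessian (pderiv j F) w i k := by
  simp only [hessian_apply]
  rw [pderiv_pderiv_comm k i, pderiv_pderiv_comm j i, pderiv_pderiv_comm k j]

lemma hessian_nonneg {F : MvPolynomial (Fin N) ℝ} (hF : ∀ m, 0 ≤ F.coeff m) {w : Fin N → ℝ}
    (hw : ∀ i, 0 ≤ w i) (i j : Fin N) : 0 ≤ hessian F w i j :=
  eval_nonneg_of_coeff_nonneg (coeff_pderiv_nonneg (coeff_pderiv_nonneg hF j) i) hw

/-- Euler's identity for the second derivatives of a homogeneous polynomial. -/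
lemma MvPolynomial.IsHomogeneous.sum_mul_hessian_pderiv {F : MvPolynomial (Fin N) ℝ} {d : ℕ}
    (hF : F.IsHomogeneous d) (w : Fin N → ℝ) (j k : Fin N) :
    ∑ i, w i * hessian (pderiv i F) w j k = ((d - 1 - 1 : ℕ) : ℝ) * hessian F w j k := by
  have h := congrArg (eval w) ((hF.pderiv (i := k)).pderiv (i := j)).sum_X_mul_pderiv
  simp only [map_sum, map_mul, eval_X, nsmul_eq_mul, map_natCast] at h
  simp only [hessian_apply]
  rw [← h]
  refine Finset.sum_congr rfl fun i _ => ?_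
  rw [pderiv_pderiv_comm k i, pderiv_pderiv_comm j i]

end Hessian

theorem statement9 (n d : ℕ) (F : MvPolynomial (Fin (n+1)) ℝ)
    (hF : F.IsHomogeneous d) (hcoeff : ∀ m, 0 ≤ F.coeff m)
    (w : Fin (n+1) → ℝ) (hw : ∀ i, 0 < w i)
    (hsym : ∀ i, (hessian (pderiv i F) w).IsHermitian)
    (h1 : ∀ i, Fintype.card {j // 0 < (hsym i).eigenvalues j} = 1) :
    ∀ z : Fin (n+1) → ℝ,
      (hessian F w).mulVec z = 0 ↔ ∀ i, (hessian (pderiv i F) w).mulVec z = 0 := by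
  have hsum : ∀ x y : Fin (n+1) → ℝ, ∑ i, w i * (x ⬝ᵥ hessian (pderiv i F) w *ᵥ y)
      = ((d - 1 - 1 : ℕ) : ℝ) * (x ⬝ᵥ hessian F w *ᵥ y) := by
    intro x y
    have hM : ∑ i, w i • hessian (pderiv i F) w = ((d - 1 - 1 : ℕ) : ℝ) • hessian F w := by
      ext j k
      simpa [Matrix.sum_apply] using hF.sum_mul_hessian_pderiv w j k
    have h := congrArg (fun M => x ⬝ᵥ M *ᵥ y) hM
    simpa [Matrix.sum_mulVec, dotProduct_sum, smul_mulVec] using h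
  have hrow : ∀ (i : Fin (n+1)) (z : Fin (n+1) → ℝ), w ⬝ᵥ hessian (pderiv i F) w *ᵥ z
      = ((d - 1 - 1 : ℕ) : ℝ) * (hessian F w *ᵥ z) i := by
    intro i z
    have h := hsum (Pi.single i 1) z
    simp only [single_one_dotProduct] at h
    rw [← h]
    refine Finset.sum_congr rfl fun j _ => ?_
    simp only [mulVec, dotProduct, hessian_pderiv_apply_comm F w i j]
  have hpos : ∀ i, 0 < w ⬝ᵥ hessian (pderiv i F) w *ᵥ w := by
    intro i
    have hnn := hessian_nonneg (coeff_pderiv_nonneg hcoeff i) (fun j => (hw j).le)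
    obtain ⟨⟨k, hk⟩, -⟩ := Fintype.card_eq_one_iff.mp (h1 i)
    have hne : hessian (pderiv i F) w ≠ 0 := fun h0 => by
      rw [← (hsym i).eigenvalues_eq_zero_iff] at h0
      simp [h0] at hk
    obtain ⟨a, b, hab⟩ : ∃ a b, hessian (pderiv i F) w a b ≠ 0 := by
      by_contra! hc
      exact hne (Matrix.ext hc)
    have hterm : ∀ j k, 0 ≤ hessian (pderiv i F) w j k * w k := fun j k =>
      mul_nonneg (hnn j k) (hw k).le
    have hmul : ∀ j, 0 ≤ (hessian (pderiv i F) w *ᵥ w) j := fun j => by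
      rw [mulVec, dotProduct]
      exact Finset.sum_nonneg fun k _ => hterm j k
    refine Finset.sum_pos' (fun j _ => mul_nonneg (hw j).le (hmul j))
      ⟨a, Finset.mem_univ _, mul_pos (hw a) ?_⟩
    exact Finset.sum_pos' (fun k _ => hterm a k)
      ⟨b, Finset.mem_univ _, mul_pos (lt_of_le_of_ne (hnn a b) hab.symm) (hw b)⟩
  have hc : ((d - 1 - 1 : ℕ) : ℝ) ≠ 0 := fun h => by
    have := hpos 0
    rw [hrow, h, zero_mul] at this
    exact this.false
  refine fun z => ⟨fun hz i => ?_, fun hz => funext fun i => ?_⟩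
  · choose v hv using fun i => (hsym i).exists_dotProduct_mulVec_nonpos (h1 i)
    have hort : ∀ i, w ⬝ᵥ hessian (pderiv i F) w *ᵥ z = 0 := fun i => by simp [hrow, hz]
    have hnonpos := fun i =>
      (hessian_isSymm (pderiv i F) w).dotProduct_mulVec_nonpos (hv i) (hpos i) (hort i)
    have hzero : ∑ i, w i * (z ⬝ᵥ hessian (pderiv i F) w *ᵥ z) = 0 := by simp [hsum, hz]
    have hi := (Finset.sum_eq_zero_iff_of_nonpos fun i _ =>
      mul_nonpos_of_nonneg_of_nonpos (hw i).le (hnonpos i)).mp hzero i (Finset.mem_univ i)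
    exact (hessian_isSymm (pderiv i F) w).mulVec_eq_zero_of_dotProduct_mulVec_eq_zero (hv i)
      (hpos i) (hort i) ((mul_eq_zero.mp hi).resolve_left (hw i).ne')
  · have h := hrow i z
    rw [hz i, dotProduct_zero] at h
    exact (mul_eq_zero.mp h.symm).resolve_left hc
end

section
/- Let n ≥ 2 and let M be a matroid on [n]. Then for every 0 < m < n and every w ∈ ℝ^n with all coordinates nonnegative, f^m_M(w)² / C(n,m)² ≥ (f^{m+1}_M(w) / C(n,m+1)) · (f^{m−1}_M(w) / C(n,m−1)), where C(n,k) denotes the binomial coefficient. -/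
open Finset

/-- Rank-function axioms for a matroid on `[n]` (Oxley, Theorem 1.3.2).
A set `A` is independent if and only if `rk A = A.card`. -/
def IsMatroidRank (n : ℕ) (rk : Finset (Fin n) → ℕ) : Prop :=
  (∀ A, rk A ≤ A.card) ∧
  (∀ A B, A ⊆ B → rk A ≤ rk B) ∧
  (∀ A B : Finset (Fin n), rk (A ∪ B) + rk (A ∩ B) ≤ rk A + rk B)

/-- `f^m_M(w)`, the `m`-th generating function of the matroid: the sum over all
independent sets of size `m` of the corresponding squarefree monomials. -/
noncomputable def fm (n : ℕ) (rk : Finset (Fin n) → ℕ) (m : ℕ) (w : Fin n → ℝ) : ℝ :=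
  ∑ A ∈ (Finset.powersetCard m (Finset.univ : Finset (Fin n))).filter
      (fun A => rk A = A.card), ∏ i ∈ A, w i

/-- `I_k(M)`, the number of `k`-element independent sets of the matroid. -/
def Ik (n : ℕ) (rk : Finset (Fin n) → ℕ) (k : ℕ) : ℕ :=
  ((Finset.powersetCard k (Finset.univ : Finset (Fin n))).filter
    (fun A => rk A = A.card)).card

open Matrix

section Hyperbolic

variable {ι : Type*} [Fintype ι]

/-- The reverse Cauchy–Schwarz inequality of the bilinear form of `M` against the vector `w`. -/
def IsHyperbolicAt (M : Matrix ι ι ℝ) (w : ι → ℝ) : Prop :=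
  ∀ x, (x ⬝ᵥ M *ᵥ x) * (w ⬝ᵥ M *ᵥ w) ≤ (x ⬝ᵥ M *ᵥ w) ^ 2

theorem dotProduct_mulVec_comm_of_isSymm {M : Matrix ι ι ℝ} (hM : M.IsSymm) (x y : ι → ℝ) :
    x ⬝ᵥ M *ᵥ y = y ⬝ᵥ M *ᵥ x := by
  rw [dotProduct_mulVec, dotProduct_comm, ← mulVec_transpose, hM.eq]

theorem isHyperbolicAt_of_nonpos_on_ker {M : Matrix ι ι ℝ} (hM : M.IsSymm) {w : ι → ℝ}
    (hw : 0 ≤ w ⬝ᵥ M *ᵥ w) (l : ι → ℝ) (hl : ∀ x, l ⬝ᵥ x = 0 → x ⬝ᵥ M *ᵥ x ≤ 0) :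
    IsHyperbolicAt M w := by
  intro x
  rcases hw.eq_or_lt with h0 | hpos
  · rw [← h0, mul_zero]; positivity
  have hlw : l ⬝ᵥ w ≠ 0 := fun h => (hl w h).not_gt hpos
  set t := (l ⬝ᵥ x) / (l ⬝ᵥ w) with ht
  have hker : l ⬝ᵥ (x - t • w) = 0 := by
    rw [dotProduct_sub, dotProduct_smul, smul_eq_mul, ht, div_mul_cancel₀ _ hlw, sub_self]
  have h := hl _ hker
  simp only [mulVec_sub, mulVec_smul, sub_dotProduct, dotProduct_sub, smul_dotProduct,
    dotProduct_smul, smul_eq_mul, dotProduct_mulVec_comm_of_isSymm hM w x] at h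
  nlinarith [sq_nonneg (t * (w ⬝ᵥ M *ᵥ w) - x ⬝ᵥ M *ᵥ w),
    mul_le_mul_of_nonneg_right h hpos.le]

theorem dotProduct_mulVec_nonpos_of_eigenvectors [DecidableEq ι] {N : Matrix ι ι ℝ}
    (hN : N.IsSymm) {z : ι → ℝ}
    (h : ∀ (u : ι → ℝ) (μ : ℝ), 0 < μ → N *ᵥ u = μ • u → u ⬝ᵥ z = 0) :
    z ⬝ᵥ N *ᵥ z ≤ 0 := by
  have hH : N.IsHermitian := by
    rw [Matrix.IsHermitian, conjTranspose_eq_transpose_of_trivial, hN.eq]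
  have key := hH.eigenvectorBasis.sum_inner_mul_inner (WithLp.toLp 2 z) (WithLp.toLp 2 (N *ᵥ z))
  have hin : ∀ x y : EuclideanSpace ℝ ι, inner ℝ x y = x.ofLp ⬝ᵥ y.ofLp := by
    intro x y
    rw [EuclideanSpace.inner_eq_star_dotProduct, star_trivial, dotProduct_comm]
  simp only [hin] at key
  rw [← key]
  refine Finset.sum_nonpos fun k _ => ?_
  have he := hH.mulVec_eigenvectorBasis k
  set u := (hH.eigenvectorBasis k).ofLp
  rw [dotProduct_mulVec_comm_of_isSymm hN u z, he, dotProduct_smul, smul_eq_mul]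
  rcases le_or_gt (hH.eigenvalues k) 0 with hneg | hpos
  · nlinarith [mul_self_nonneg (z ⬝ᵥ u)]
  · rw [dotProduct_comm z u, h u _ hpos he]; simp

theorem sum_mul_sq_div_sub_div {M : Matrix ι ι ℝ} (hM : M.IsSymm) {w : ι → ℝ}
    (hw : ∀ i, 0 < w i) (v : ι → ℝ) :
    ∑ i, ∑ j, M i j * w i * w j * (v i / w i - v j / w j) ^ 2 =
      2 * ∑ i, (M *ᵥ w) i * (v i ^ 2 / w i) - 2 * (v ⬝ᵥ M *ᵥ v) := by
  have h1 : ∀ i j, M i j * w i * w j * (v i / w i - v j / w j) ^ 2 =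
      M i j * w j * (v i ^ 2 / w i) + M j i * w i * (v j ^ 2 / w j) -
        2 * (v i * (M i j * v j)) := by
    intro i j
    have := (hw i).ne'
    have := (hw j).ne'
    rw [hM.apply i j]
    field_simp
    ring
  have h2 : ∑ i, ∑ j, M j i * w i * (v j ^ 2 / w j) =
      ∑ i, ∑ j, M i j * w j * (v i ^ 2 / w i) := Finset.sum_comm
  simp only [h1, Finset.sum_add_distrib, Finset.sum_sub_distrib, h2]
  simp only [mulVec, dotProduct, Finset.mul_sum, Finset.sum_mul, two_mul]
  simp only [Finset.sum_add_distrib]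

/-- A symmetric nonnegative matrix satisfying a Bochner-type inequality with respect to a positive
vector `w`, and with an index adjacent to every nonzero row, is negative semidefinite on the
orthogonal complement of `M *ᵥ w`. -/
theorem dotProduct_mulVec_nonpos_of_bochner [DecidableEq ι] {M : Matrix ι ι ℝ} (hM : M.IsSymm)
    (hM0 : ∀ i j, 0 ≤ M i j) {w : ι → ℝ} (hw : ∀ i, 0 < w i) (o : ι)
    (ho : ∀ i, (M *ᵥ w) i ≠ 0 → 0 < M o i)
    (hB : ∀ x, x ⬝ᵥ M *ᵥ x ≤ ∑ i, w i * (M *ᵥ x) i ^ 2 / (M *ᵥ w) i)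
    {x : ι → ℝ} (hx : (M *ᵥ w) ⬝ᵥ x = 0) : x ⬝ᵥ M *ᵥ x ≤ 0 := by
  set r := M *ᵥ w with hr
  have hr0 : ∀ i, 0 ≤ r i := fun i => Finset.sum_nonneg fun j _ => mul_nonneg (hM0 i j) (hw j).le
  have hrow : ∀ i, r i = 0 → ∀ j, M i j = 0 := by
    intro i hi j
    have := (Finset.sum_eq_zero_iff_of_nonneg
      (fun j _ => mul_nonneg (hM0 i j) (hw j).le)).1 hi j (mem_univ j)
    exact (mul_eq_zero.1 this).resolve_right (hw j).ne'
  have hcol : ∀ j, r j = 0 → ∀ i, M i j = 0 := fun j hj i => by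
    rw [← hM.apply, hrow j hj]
  have hmv : ∀ i, r i = 0 → ∀ y, (M *ᵥ y) i = 0 := fun i hi y =>
    Finset.sum_eq_zero fun j _ => by simp [hrow i hi j]
  set q : ι → ℝ := fun i => √(w i / r i) with hq
  set N : Matrix ι ι ℝ := of fun i j => q i * M i j * q j with hNdef
  set z : ι → ℝ := fun i => √(r i / w i) * x i with hz
  have hqz : ∀ i, r i ≠ 0 → q i * z i = x i := by
    intro i hi
    have : √(w i / r i) * √(r i / w i) = 1 := by
      rw [← Real.sqrt_mul (div_nonneg (hw i).le (hr0 i)), div_mul_div_cancel₀ hi,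
        div_self (hw i).ne', Real.sqrt_one]
    simp only [hq, hz]
    rw [← mul_assoc, this, one_mul]
  have hqq : ∀ i, q i ^ 2 = w i / r i := fun i =>
    Real.sq_sqrt (div_nonneg (hw i).le (hr0 i))
  have hN : N.IsSymm := by
    ext i j
    simp only [hNdef, transpose_apply, of_apply]
    rw [hM.apply i j]; ring
  have hNmv : ∀ u i, (N *ᵥ u) i = q i * (M *ᵥ fun j => q j * u j) i := by
    intro u i
    simp only [hNdef, mulVec, dotProduct, of_apply, Finset.mul_sum]
    exact Finset.sum_congr rfl fun j _ => by ring
  have hxz : x ⬝ᵥ M *ᵥ x = z ⬝ᵥ N *ᵥ z := by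
    simp only [dotProduct, hNmv]
    refine Finset.sum_congr rfl fun i _ => ?_
    by_cases hi : r i = 0
    · simp [hmv i hi]
    · rw [← hqz i hi]
      have : (M *ᵥ x) i = (M *ᵥ fun j => q j * z j) i := by
        refine Finset.sum_congr rfl fun j _ => ?_
        by_cases hj : r j = 0
        · simp [hcol j hj]
        · exact congrArg _ (hqz j hj).symm
      rw [this]; ring
  rw [hxz]
  refine dotProduct_mulVec_nonpos_of_eigenvectors hN fun u μ hμ hu => ?_
  set v : ι → ℝ := fun j => q j * u j with hv
  have hu' : ∀ i, q i * (M *ᵥ v) i = μ * u i := fun i => by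
    rw [← hNmv, hu, Pi.smul_apply, smul_eq_mul]
  have hvMv : v ⬝ᵥ M *ᵥ v = μ * ∑ i, u i ^ 2 := by
    rw [Finset.mul_sum]
    refine Finset.sum_congr rfl fun i _ => ?_
    calc q i * u i * (M *ᵥ v) i = u i * (q i * (M *ᵥ v) i) := by ring
      _ = μ * u i ^ 2 := by rw [hu']; ring
  have hBv : μ * ∑ i, u i ^ 2 ≤ μ ^ 2 * ∑ i, u i ^ 2 := by
    rw [← hvMv]
    refine (hB v).trans_eq ?_
    rw [Finset.mul_sum]
    refine Finset.sum_congr rfl fun i _ => ?_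
    rw [← mul_pow, ← hu', mul_pow, hqq]; ring
  have hrv : ∑ i, r i * (v i ^ 2 / w i) ≤ ∑ i, u i ^ 2 := by
    refine Finset.sum_le_sum fun i _ => ?_
    by_cases hi : r i = 0
    · rw [hi, zero_mul]; positivity
    · have := (hw i).ne'
      simp only [hv, mul_pow, hqq]
      apply le_of_eq; field_simp
  have hlap := sum_mul_sq_div_sub_div hM hw v
  have hterm : ∀ i j, 0 ≤ M i j * w i * w j * (v i / w i - v j / w j) ^ 2 := fun i j =>
    mul_nonneg (mul_nonneg (mul_nonneg (hM0 i j) (hw i).le) (hw j).le) (sq_nonneg _)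
  have hle : ∑ i, ∑ j, M i j * w i * w j * (v i / w i - v j / w j) ^ 2 ≤ 0 := by
    rw [hlap, hvMv]
    have : ∑ i, u i ^ 2 ≤ μ * ∑ i, u i ^ 2 := by
      refine le_of_mul_le_mul_left ?_ hμ
      linarith
    linarith
  have hv_eq : ∀ i, r i ≠ 0 → v i = v o / w o * w i := by
    intro i hi
    have h0 := le_antisymm hle (Finset.sum_nonneg fun i _ => Finset.sum_nonneg fun j _ => hterm i j)
    have h1 := (Finset.sum_eq_zero_iff_of_nonneg
      (fun i _ => Finset.sum_nonneg fun j _ => hterm i j)).1 h0 o (mem_univ o)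
    have h2 := (Finset.sum_eq_zero_iff_of_nonneg (fun j _ => hterm o j)).1 h1 i (mem_univ i)
    have hpos := mul_pos (mul_pos (ho i hi) (hw o)) (hw i)
    have h3 := pow_eq_zero_iff two_ne_zero |>.1 ((mul_eq_zero.1 h2).resolve_left hpos.ne')
    rw [sub_eq_zero.1 h3, div_mul_cancel₀ _ (hw i).ne']
  have hMv : M *ᵥ v = (v o / w o) • r := by
    rw [hr, ← mulVec_smul]
    ext i
    refine Finset.sum_congr rfl fun j _ => ?_
    by_cases hj : r j = 0
    · simp [hcol j hj]
    · rw [hv_eq j hj, Pi.smul_apply, smul_eq_mul]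
  have hfin : μ * (u ⬝ᵥ z) = v o / w o * (r ⬝ᵥ x) := by
    rw [← smul_eq_mul (a := v o / w o), ← smul_dotProduct, ← hMv]
    simp only [dotProduct, Finset.mul_sum]
    refine Finset.sum_congr rfl fun i _ => ?_
    by_cases hi : r i = 0
    · rw [← mul_assoc, ← hu', hmv i hi]; simp
    · rw [← hqz i hi, ← mul_assoc, ← hu']; ring
  rw [hx, mul_zero] at hfin
  exact (mul_eq_zero.1 hfin).resolve_left hμ.ne'

end Hyperbolic

section SymEval

variable {ι : Type*} [Fintype ι]

/-- The value at `w` of the `s`-th partial derivative of the form whose partial derivatives of order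
`card s + d` are the constants `c`. -/
noncomputable def symEval (c : Multiset ι → ℝ) (w : ι → ℝ) : ℕ → Multiset ι → ℝ
  | 0, s => c s
  | d + 1, s => (∑ i, w i * symEval c w d (i ::ₘ s)) / (d + 1)

/-- The Hessian at `w` of the `s`-th partial derivative, of degree `d + 2`, of the form with
coefficients `c`. -/
noncomputable def symHess (c : Multiset ι → ℝ) (w : ι → ℝ) (d : ℕ) (s : Multiset ι) :
    Matrix ι ι ℝ :=
  of fun i j => symEval c w d (i ::ₘ j ::ₘ s)

variable {c : Multiset ι → ℝ} {w : ι → ℝ}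

theorem sum_mul_symEval_cons (c : Multiset ι → ℝ) (w : ι → ℝ) (d : ℕ) (s : Multiset ι) :
    ∑ i, w i * symEval c w d (i ::ₘ s) = (d + 1) * symEval c w (d + 1) s := by
  rw [symEval, mul_div_cancel₀ _ (by positivity)]

theorem symEval_nonneg (hc : ∀ s, 0 ≤ c s) (hw : ∀ i, 0 ≤ w i) (d : ℕ) (s : Multiset ι) :
    0 ≤ symEval c w d s := by
  induction d generalizing s with
  | zero => exact hc s
  | succ d ih =>
    exact div_nonneg (Finset.sum_nonneg fun i _ => mul_nonneg (hw i) (ih _)) (by positivity)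

theorem coeff_ne_zero_of_symEval_ne_zero (hc : ∀ i s, c (i ::ₘ s) ≠ 0 → c s ≠ 0) {d : ℕ}
    {s : Multiset ι} (h : symEval c w d s ≠ 0) : c s ≠ 0 := by
  induction d generalizing s with
  | zero => exact h
  | succ d ih =>
    contrapose! h
    rw [symEval, Finset.sum_eq_zero, zero_div]
    intro i _
    rw [mul_eq_zero]
    right
    by_contra hne
    exact hc i s (ih hne) h

theorem symEval_pos (hc : ∀ s, 0 ≤ c s) (hw : ∀ i, 0 < w i) {o : ι}
    (ho : ∀ s, c s ≠ 0 → c (o ::ₘ s) ≠ 0) (d : ℕ) {s : Multiset ι} (h : c s ≠ 0) :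
    0 < symEval c w d s := by
  induction d generalizing s with
  | zero => exact (hc s).lt_of_ne' h
  | succ d ih =>
    refine div_pos (Finset.sum_pos' (fun i _ => mul_nonneg (hw i).le
      (symEval_nonneg hc (fun i => (hw i).le) d _)) ⟨o, mem_univ o, ?_⟩) (by positivity)
    exact mul_pos (hw o) (ih (ho s h))

theorem continuous_symEval (c : Multiset ι → ℝ) (d : ℕ) (s : Multiset ι) :
    Continuous fun w => symEval c w d s := by
  induction d generalizing s with
  | zero => exact continuous_const
  | succ d ih =>
    simp only [symEval]
    fun_prop

theorem symHess_isSymm (c : Multiset ι → ℝ) (w : ι → ℝ) (d : ℕ) (s : Multiset ι) :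
    (symHess c w d s).IsSymm := by
  ext i j
  simp only [symHess, transpose_apply, of_apply, Multiset.cons_swap]

theorem symHess_mulVec (c : Multiset ι → ℝ) (w : ι → ℝ) (d : ℕ) (s : Multiset ι) (i : ι) :
    (symHess c w d s *ᵥ w) i = (d + 1) * symEval c w (d + 1) (i ::ₘ s) := by
  rw [← sum_mul_symEval_cons]
  simp only [symHess, mulVec, dotProduct, of_apply]
  exact Finset.sum_congr rfl fun j _ => by rw [Multiset.cons_swap, mul_comm]

theorem dotProduct_symHess_mulVec (c : Multiset ι → ℝ) (w : ι → ℝ) (d : ℕ) (s : Multiset ι) :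
    w ⬝ᵥ symHess c w d s *ᵥ w = (d + 1) * ((d + 2) * symEval c w (d + 2) s) := by
  have h := sum_mul_symEval_cons c w (d + 1) s
  push_cast at h
  rw [add_assoc, one_add_one_eq_two] at h
  rw [← h, Finset.mul_sum]
  simp only [dotProduct, symHess_mulVec]
  exact Finset.sum_congr rfl fun i _ => by ring

theorem sum_mul_dotProduct_symHess_cons (c : Multiset ι → ℝ) (w : ι → ℝ) (d : ℕ)
    (s : Multiset ι) (x : ι → ℝ) :
    ∑ i, w i * (x ⬝ᵥ symHess c w d (i ::ₘ s) *ᵥ x) =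
      (d + 1) * (x ⬝ᵥ symHess c w (d + 1) s *ᵥ x) := by
  have h : ∀ j k, ∑ i, w i * symEval c w d (j ::ₘ k ::ₘ i ::ₘ s) =
      (d + 1) * symEval c w (d + 1) (j ::ₘ k ::ₘ s) := by
    intro j k
    rw [← sum_mul_symEval_cons]
    refine Finset.sum_congr rfl fun i _ => ?_
    rw [Multiset.cons_swap k, Multiset.cons_swap j]
  simp only [dotProduct, mulVec, symHess, of_apply, Finset.mul_sum]
  rw [Finset.sum_comm]
  refine Finset.sum_congr rfl fun j _ => ?_
  rw [Finset.sum_comm]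
  refine Finset.sum_congr rfl fun k _ => ?_
  calc _ = x j * x k * ∑ i, w i * symEval c w d (j ::ₘ k ::ₘ i ::ₘ s) := by
        rw [Finset.mul_sum]; exact Finset.sum_congr rfl fun i _ => by ring
    _ = _ := by rw [h]; ring

theorem symHess_cons_mulVec (c : Multiset ι → ℝ) (w : ι → ℝ) (d : ℕ) (s : Multiset ι) (i : ι) :
    symHess c w d (i ::ₘ s) *ᵥ w = ((d : ℝ) + 1) • fun j => symHess c w (d + 1) s i j := by
  ext j
  rw [symHess_mulVec, Pi.smul_apply, smul_eq_mul, symHess, of_apply, Multiset.cons_swap]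

/-- Local-to-global principle: hyperbolicity of the Hessians of all quadratic derivatives
propagates to the derivatives of higher degree. -/
theorem isHyperbolicAt_symHess [DecidableEq ι] (hc : ∀ s, 0 ≤ c s)
    (hc' : ∀ i s, c (i ::ₘ s) ≠ 0 → c s ≠ 0) {o : ι} (ho : ∀ s, c s ≠ 0 → c (o ::ₘ s) ≠ 0)
    (hw : ∀ i, 0 < w i) {n : ℕ}
    (hbase : ∀ s, Multiset.card s + 2 ≤ n → IsHyperbolicAt (symHess c w 0 s) w) (d : ℕ)
    (s : Multiset ι) (hs : Multiset.card s + d + 2 ≤ n) : IsHyperbolicAt (symHess c w d s) w := by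
  have hw' := fun i => (hw i).le
  induction d generalizing s with
  | zero => exact hbase s hs
  | succ d ih =>
    have hd : (0 : ℝ) < d + 1 := by positivity
    set M := symHess c w (d + 1) s with hMdef
    have hM := symHess_isSymm c w (d + 1) s
    refine isHyperbolicAt_of_nonpos_on_ker hM ?_ (M *ᵥ w) fun x hx =>
      dotProduct_mulVec_nonpos_of_bochner hM (fun i j => symEval_nonneg hc hw' _ _) hw o ?_ ?_ hx
    · rw [dotProduct_symHess_mulVec]
      have := symEval_nonneg hc hw' (d + 1 + 2) s
      positivity
    · intro i hi
      rw [symHess_mulVec] at hi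
      exact symEval_pos hc hw ho _ (ho _ (coeff_ne_zero_of_symEval_ne_zero hc'
        (right_ne_zero_of_mul hi)))
    · intro x
      refine le_of_mul_le_mul_left ?_ hd
      rw [← sum_mul_dotProduct_symHess_cons, Finset.mul_sum]
      refine Finset.sum_le_sum fun i _ => ?_
      have hyp := ih (i ::ₘ s) (by rw [Multiset.card_cons]; omega) x
      have hxw : x ⬝ᵥ symHess c w d (i ::ₘ s) *ᵥ w = (d + 1) * (M *ᵥ x) i := by
        rw [symHess_cons_mulVec, dotProduct_smul, smul_eq_mul, dotProduct_comm]; rfl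
      have hww : w ⬝ᵥ symHess c w d (i ::ₘ s) *ᵥ w = (d + 1) * (M *ᵥ w) i := by
        rw [symHess_cons_mulVec, dotProduct_smul, smul_eq_mul, dotProduct_comm]; rfl
      rw [hxw, hww] at hyp
      have hr0 : 0 ≤ (M *ᵥ w) i := Finset.sum_nonneg fun j _ =>
        mul_nonneg (symEval_nonneg hc hw' _ _) (hw' j)
      rcases hr0.eq_or_lt with hi | hi
      · have hzero : x ⬝ᵥ symHess c w d (i ::ₘ s) *ᵥ x = 0 := by
          have hci : c (i ::ₘ s) = 0 := by
            by_contra hne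
            have := symEval_pos hc hw ho (d + 2) hne
            rw [hMdef, symHess_mulVec] at hi
            push_cast at hi
            exact (mul_pos (by positivity) this).ne hi
          refine Finset.sum_eq_zero fun j _ => mul_eq_zero_of_right _ ?_
          refine Finset.sum_eq_zero fun k _ => mul_eq_zero_of_left ?_ _
          by_contra hne
          exact hc' _ _ (hc' _ _ (coeff_ne_zero_of_symEval_ne_zero hc' hne)) hci
        rw [hzero, ← hi]; simp
      · have : x ⬝ᵥ symHess c w d (i ::ₘ s) *ᵥ x ≤ (d + 1) * (M *ᵥ x) i ^ 2 / (M *ᵥ w) i := by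
          rw [le_div_iff₀ hi]
          refine le_of_mul_le_mul_left ?_ hd
          linarith
        calc _ ≤ w i * ((d + 1) * (M *ᵥ x) i ^ 2 / (M *ᵥ w) i) :=
              mul_le_mul_of_nonneg_left this (hw' i)
          _ = _ := by ring

end SymEval

section Matroid

open scoped Nat

variable {n : ℕ} {rk : Finset (Fin n) → ℕ}

theorem IsMatroidRank.insert_le (h : IsMatroidRank n rk) (j : Fin n) (A : Finset (Fin n)) :
    rk (insert j A) ≤ rk A + 1 := by
  have h1 := h.2.2 {j} A
  have h2 := h.1 {j}
  rw [card_singleton] at h2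
  rw [insert_eq]
  omega

theorem IsMatroidRank.le_insert (h : IsMatroidRank n rk) (j : Fin n) (A : Finset (Fin n)) :
    rk A ≤ rk (insert j A) :=
  h.2.1 _ _ (subset_insert j A)

/-- Parallelism of nonloops in the contraction by `A` is transitive. -/
theorem IsMatroidRank.parallel_trans (h : IsMatroidRank n rk) {A : Finset (Fin n)} {j l p : Fin n}
    (hj : rk (insert j A) = rk A + 1) (hl : rk (insert l A) = rk A + 1)
    (hjl : rk (insert j (insert l A)) = rk A + 1) (hlp : rk (insert l (insert p A)) = rk A + 1) :
    rk (insert j (insert p A)) = rk A + 1 := by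
  have h1 := h.2.2 (insert j (insert l A)) (insert l (insert p A))
  have h2 : rk (insert l A) ≤ rk (insert j (insert l A) ∩ insert l (insert p A)) :=
    h.2.1 _ _ (by intro a; simp only [mem_inter, mem_insert]; tauto)
  have h3 : rk (insert j (insert p A)) ≤ rk (insert j (insert l A) ∪ insert l (insert p A)) :=
    h.2.1 _ _ (by intro a; simp only [mem_union, mem_insert]; tauto)
  have h4 : rk (insert j A) ≤ rk (insert j (insert p A)) :=
    h.2.1 _ _ (insert_subset_insert _ (subset_insert _ _))
  omega

/-- Cauchy–Schwarz over the parallel classes of the contraction by `A`. -/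
theorem IsMatroidRank.sq_sum_le (h : IsMatroidRank n rk) (A : Finset (Fin n)) (x : Fin n → ℝ)
    {L : Finset (Fin n)} (hL : ∀ j, j ∈ L ↔ rk (insert j A) = rk A + 1) :
    (∑ j ∈ L, x j) ^ 2 ≤ ((n - #A : ℕ) : ℝ) *
      ∑ j ∈ L, ∑ l ∈ L, if rk (insert j (insert l A)) = rk A + 1 then x j * x l else 0 := by
  set f : Fin n → Finset (Fin n) := fun j =>
    {l ∈ L | rk (insert j (insert l A)) = rk A + 1} with hf
  have hff : ∀ j ∈ L, ∀ l ∈ L, f l = f j ↔ rk (insert j (insert l A)) = rk A + 1 := by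
    intro j hj l hl
    have hj' := (hL j).1 hj
    have hl' := (hL l).1 hl
    constructor
    · intro he
      have : l ∈ f l := by simp [hf, hl, hl']
      rw [he] at this
      exact (mem_filter.1 this).2
    · intro hjl
      have hlj : rk (insert l (insert j A)) = rk A + 1 := by rw [insert_comm, hjl]
      ext p
      simp only [hf, mem_filter, and_congr_right_iff]
      exact fun _ => ⟨h.parallel_trans hj' hl' hjl, h.parallel_trans hl' hj' hlj⟩
  have hmaps : ∀ j ∈ L, f j ∈ L.image f := fun j hj => mem_image_of_mem f hj
  have hcard : #(L.image f) ≤ n - #A := by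
    refine card_image_le.trans ?_
    have hsub : L ⊆ Aᶜ := by
      intro j hj
      rw [mem_compl]
      intro hjA
      have := (hL j).1 hj
      rw [insert_eq_of_mem hjA] at this
      omega
    simpa [card_compl] using card_le_card hsub
  have hQ : ∑ j ∈ L, ∑ l ∈ L, (if rk (insert j (insert l A)) = rk A + 1 then x j * x l else 0) =
      ∑ C ∈ L.image f, (∑ j ∈ L with f j = C, x j) ^ 2 := by
    rw [← sum_fiberwise_of_maps_to hmaps]
    refine sum_congr rfl fun C _ => ?_
    rw [sq, sum_mul]
    refine sum_congr rfl fun j hj => ?_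
    obtain ⟨hjL, rfl⟩ := mem_filter.1 hj
    rw [mul_sum, sum_filter]
    exact sum_congr rfl fun l hl => if_congr (hff j hjL l hl).symm rfl rfl
  rw [hQ, ← sum_fiberwise_of_maps_to hmaps]
  refine sq_sum_le_card_mul_sum_sq.trans ?_
  exact mul_le_mul_of_nonneg_right (by exact_mod_cast hcard) (sum_nonneg fun _ _ => sq_nonneg _)

/-- The normalized coefficients of the homogenized independent set polynomial of a matroid, the
index `none` standing for the homogenizing variable. -/
noncomputable def matroidCoeff (n : ℕ) (rk : Finset (Fin n) → ℕ) (s : Multiset (Option (Fin n))) :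
    ℝ :=
  if rk (s.filterMap id).toFinset = Multiset.card (s.filterMap id) then
    ((n - Multiset.card (s.filterMap id))! : ℝ) else 0

theorem matroidCoeff_nonneg (s : Multiset (Option (Fin n))) : 0 ≤ matroidCoeff n rk s := by
  unfold matroidCoeff
  split_ifs <;> positivity

theorem matroidCoeff_ne_zero_iff {s : Multiset (Option (Fin n))} : matroidCoeff n rk s ≠ 0 ↔
    rk (s.filterMap id).toFinset = Multiset.card (s.filterMap id) := by
  simp [matroidCoeff, Nat.factorial_ne_zero]

theorem matroidCoeff_none_cons (s : Multiset (Option (Fin n))) :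
    matroidCoeff n rk (none ::ₘ s) = matroidCoeff n rk s := by
  rw [matroidCoeff, matroidCoeff, Multiset.filterMap_cons_none _ _ rfl]

theorem IsMatroidRank.le_card (h : IsMatroidRank n rk) (J : Multiset (Fin n)) :
    rk J.toFinset ≤ Multiset.card J :=
  (h.1 _).trans J.toFinset_card_le

theorem IsMatroidRank.matroidCoeff_of_cons (h : IsMatroidRank n rk) (i : Option (Fin n))
    (s : Multiset (Option (Fin n))) (hi : matroidCoeff n rk (i ::ₘ s) ≠ 0) :
    matroidCoeff n rk s ≠ 0 := by
  cases i with
  | none => rwa [matroidCoeff_none_cons] at hi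
  | some j =>
    rw [matroidCoeff_ne_zero_iff, Multiset.filterMap_cons_some id (some j) s rfl,
      Multiset.toFinset_cons, Multiset.card_cons] at hi
    rw [matroidCoeff_ne_zero_iff]
    have := h.insert_le j (s.filterMap id).toFinset
    have := h.le_card (s.filterMap id)
    omega

theorem IsMatroidRank.isHyperbolicAt_symHess_zero (h : IsMatroidRank n rk)
    {w : Option (Fin n) → ℝ} (hw : ∀ i, 0 ≤ w i) (s : Multiset (Option (Fin n)))
    (hs : Multiset.card s + 2 ≤ n) : IsHyperbolicAt (symHess (matroidCoeff n rk) w 0 s) w := by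
  by_cases hs0 : matroidCoeff n rk s = 0
  · have hz : ∀ y z : Option (Fin n) → ℝ,
        y ⬝ᵥ symHess (matroidCoeff n rk) w 0 s *ᵥ z = 0 := by
      have hzero : symHess (matroidCoeff n rk) w 0 s = 0 := by
        ext j k
        by_contra hne
        exact h.matroidCoeff_of_cons _ _ (h.matroidCoeff_of_cons _ _ hne) hs0
      intro y z
      rw [hzero, zero_mulVec, dotProduct_zero]
    intro x
    simp [hz]
  set J := s.filterMap id with hJ
  set A := J.toFinset with hA
  have hind : rk A = Multiset.card J := matroidCoeff_ne_zero_iff.1 hs0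
  have hAcard : #A = Multiset.card J := le_antisymm J.toFinset_card_le (hind ▸ h.1 A)
  have hJs : Multiset.card J ≤ Multiset.card s := by
    induction s using Quotient.inductionOn with | _ l => exact List.length_filterMap_le id l
  obtain ⟨t, ht⟩ : ∃ t, n - Multiset.card J = t + 2 := ⟨n - Multiset.card J - 2, by omega⟩
  set L : Finset (Fin n) := {j | rk (insert j A) = rk A + 1} with hLdef
  have hL : ∀ j, j ∈ L ↔ rk (insert j A) = rk A + 1 := fun j => by simp [hLdef]
  have hnn : matroidCoeff n rk (none ::ₘ none ::ₘ s) = (t + 2) * (t + 1) * t ! := by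
    rw [matroidCoeff_none_cons, matroidCoeff_none_cons, matroidCoeff, if_pos hind, ← hJ, ht,
      Nat.factorial_succ, Nat.factorial_succ]
    push_cast; ring
  have hsn : ∀ j, matroidCoeff n rk (some j ::ₘ none ::ₘ s) =
      if j ∈ L then (t + 1) * (t ! : ℝ) else 0 := by
    intro j
    rw [Multiset.cons_swap, matroidCoeff_none_cons, matroidCoeff,
      Multiset.filterMap_cons_some id (some j) s rfl, Multiset.toFinset_cons, Multiset.card_cons,
      ← hJ, ← hA, ← hind]
    refine if_congr (hL j).symm ?_ rfl
    rw [hind, show n - (Multiset.card J + 1) = t + 1 by omega, Nat.factorial_succ]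
    push_cast; ring
  have hns : ∀ j, matroidCoeff n rk (none ::ₘ some j ::ₘ s) =
      if j ∈ L then (t + 1) * (t ! : ℝ) else 0 := fun j => by rw [Multiset.cons_swap, hsn]
  have hss : ∀ j l, matroidCoeff n rk (some j ::ₘ some l ::ₘ s) =
      if j ∈ L then if l ∈ L then if rk (insert j (insert l A)) = rk A + 1 then 0 else (t ! : ℝ)
        else 0 else 0 := by
    intro j l
    rw [matroidCoeff, Multiset.filterMap_cons_some id (some j) _ rfl,
      Multiset.filterMap_cons_some id (some l) _ rfl, Multiset.toFinset_cons,
      Multiset.toFinset_cons, Multiset.card_cons, Multiset.card_cons, ← hJ, ← hA,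
      show n - (Multiset.card J + 1 + 1) = t by omega, ← hind]
    have h1 := h.insert_le j (insert l A)
    have h2 := h.insert_le l A
    have h3 := h.insert_le j A
    have h4 := h.insert_le l (insert j A)
    have h5 := h.le_insert l (insert j A)
    simp only [hL]
    rw [insert_comm l j] at h4 h5
    split_ifs <;> first | rfl | omega
  refine isHyperbolicAt_of_nonpos_on_ker (symHess_isSymm _ _ _ _) ?_
    (fun i => i.elim ((t : ℝ) + 2) fun j => if j ∈ L then 1 else 0) fun x hx => ?_
  · rw [dotProduct_symHess_mulVec]
    have := symEval_nonneg (c := matroidCoeff n rk) matroidCoeff_nonneg hw (0 + 2) s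
    positivity
  set S := ∑ j ∈ L, x (some j) with hS
  set Q := ∑ j ∈ L, ∑ l ∈ L,
    if rk (insert j (insert l A)) = rk A + 1 then x (some j) * x (some l) else 0 with hQ
  have hSQ : S ^ 2 ≤ (t + 2) * Q := by
    have := h.sq_sum_le A (fun j => x (some j)) hL
    rw [hAcard, ht] at this
    exact_mod_cast this
  have hS' : (t + 2) * x none + S = 0 := by
    rw [← hx]
    simp [dotProduct, Fintype.sum_option, hS, Finset.sum_ite_mem]
  have hquad : x ⬝ᵥ symHess (matroidCoeff n rk) w 0 s *ᵥ x =
      t ! * ((t + 2) * (t + 1) * x none ^ 2 + 2 * (t + 1) * x none * S + (S ^ 2 - Q)) := by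
    have hss' : ∑ j, x (some j) * ∑ l, matroidCoeff n rk (some j ::ₘ some l ::ₘ s) * x (some l) =
        t ! * (S ^ 2 - Q) := by
      rw [sq, hS, hQ, sum_mul_sum, ← sum_sub_distrib, mul_sum, ← Finset.sum_subset (subset_univ L)
        fun j _ hj => by simp [hss, hj]]
      refine sum_congr rfl fun j hj => ?_
      rw [← sum_sub_distrib, mul_sum, mul_sum, ← Finset.sum_subset (subset_univ L)
        fun l _ hl => by simp [hss, hl]]
      refine sum_congr rfl fun l hl => ?_
      rw [hss, if_pos hj, if_pos hl]
      split_ifs <;> ring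
    simp only [dotProduct, mulVec, symHess, of_apply, symEval, Fintype.sum_option, mul_add,
      Finset.sum_add_distrib, hss', hnn, hsn, hns]
    simp only [ite_mul, zero_mul, Finset.sum_ite_mem, univ_inter, ← Finset.mul_sum,
      mul_comm (x (some _)), ← hS]
    ring
  rw [hquad]
  refine mul_nonpos_of_nonneg_of_nonpos (by positivity) ?_
  have ht2 : (0 : ℝ) < t + 2 := by positivity
  refine nonpos_of_mul_nonpos_right ?_ ht2
  have hSe : S = -((t + 2) * x none) := by linarith
  rw [hSe] at hSQ ⊢
  nlinarith

theorem sum_sum_powersetCard_insert {α : Type*} [Fintype α] [DecidableEq α] (d : ℕ)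
    (g : Finset α → ℝ) :
    ∑ j, ∑ A ∈ powersetCard d univ with j ∉ A, g (insert j A) =
      (d + 1) * ∑ B ∈ powersetCard (d + 1) univ, g B := by
  have : ∀ B ∈ powersetCard (d + 1) (univ : Finset α), (d + 1) * g B = ∑ j ∈ B, g B := by
    intro B hB
    rw [sum_const, (mem_powersetCard.1 hB).2, nsmul_eq_mul]
    push_cast; rfl
  rw [mul_sum, sum_congr rfl this, sum_sigma', sum_sigma']
  refine sum_bij' (fun p _ => ⟨insert p.1 p.2, p.1⟩) (fun p _ => ⟨p.2, p.1.erase p.2⟩) ?_ ?_ ?_ ?_ ?_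
  · rintro ⟨j, A⟩ hp
    simp only [mem_sigma, mem_univ, true_and, mem_filter, mem_powersetCard_univ] at hp ⊢
    simp [card_insert_of_notMem hp.2, hp.1]
  · rintro ⟨B, j⟩ hp
    simp only [mem_sigma, mem_univ, true_and, mem_filter, mem_powersetCard_univ] at hp ⊢
    simp [card_erase_of_mem hp.2, hp.1]
  · rintro ⟨j, A⟩ hp
    simp only [mem_sigma, mem_univ, true_and, mem_filter] at hp
    simp [erase_insert hp.2]
  · rintro ⟨B, j⟩ hp
    simp only [mem_sigma] at hp
    simp [insert_erase hp.2]
  · intro p _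
    rfl

theorem IsMatroidRank.symEval_matroidCoeff (h : IsMatroidRank n rk) {u : Option (Fin n) → ℝ}
    (hu : u none = 0) (d : ℕ) (s : Multiset (Option (Fin n))) :
    symEval (matroidCoeff n rk) u d s = (n - (Multiset.card (s.filterMap id) + d))! *
      ∑ A ∈ powersetCard d univ,
        if rk ((s.filterMap id).toFinset ∪ A) = Multiset.card (s.filterMap id) + d then
          ∏ i ∈ A, u (some i) else 0 := by
  induction d generalizing s with
  | zero => simp [symEval, matroidCoeff]
  | succ d ih =>
    set J := s.filterMap id with hJ
    rw [symEval, div_eq_iff (by positivity), Fintype.sum_option, hu, zero_mul, zero_add, mul_assoc,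
      mul_comm _ ((d : ℝ) + 1), ← sum_sum_powersetCard_insert, mul_sum]
    refine sum_congr rfl fun j _ => ?_
    rw [ih, Multiset.filterMap_cons_some id (some j) s rfl, Multiset.toFinset_cons,
      Multiset.card_cons, ← hJ, mul_left_comm, add_assoc, add_comm 1 d]
    congr 1
    rw [mul_sum, sum_filter]
    refine sum_congr rfl fun A hA => ?_
    simp only [insert_union, union_insert]
    by_cases hj : j ∈ A
    · rw [if_neg (not_not.2 hj), if_neg, mul_zero]
      rw [insert_eq_of_mem (mem_union_right _ hj)]
      have h1 := h.1 (J.toFinset ∪ A)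
      have h2 := card_union_le J.toFinset A
      have h3 := J.toFinset_card_le
      have h4 := (mem_powersetCard.1 hA).2
      omega
    · rw [if_pos hj, prod_insert hj, mul_ite, mul_zero]

theorem IsMatroidRank.symEval_matroidCoeff_eq_fm (h : IsMatroidRank n rk)
    {u : Option (Fin n) → ℝ} (hu : u none = 0) (d : ℕ) {s : Multiset (Option (Fin n))}
    (hs : s.filterMap id = 0) :
    symEval (matroidCoeff n rk) u d s = (n - d)! * fm n rk d fun i => u (some i) := by
  rw [h.symEval_matroidCoeff hu, hs, fm, sum_filter]
  simp only [Multiset.card_zero, Multiset.toFinset_zero, empty_union, zero_add]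
  congr 1
  refine sum_congr rfl fun A hA => ?_
  rw [(mem_powersetCard.1 hA).2]

/-- The Newton-type inequality for the evaluations of the homogenized independent set polynomial. -/
theorem IsMatroidRank.symEval_mul_le (h : IsMatroidRank n rk) {d : ℕ} (hd : d + 2 ≤ n)
    {u : Option (Fin n) → ℝ} (hu : ∀ i, 0 ≤ u i) :
    symEval (matroidCoeff n rk) u d {none, none} *
        ((d + 1) * ((d + 2) * symEval (matroidCoeff n rk) u (d + 2) 0)) ≤
      ((d + 1) * symEval (matroidCoeff n rk) u (d + 1) {none}) ^ 2 := by
  have hpos : ∀ v : Option (Fin n) → ℝ, (∀ i, 0 < v i) →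
      symEval (matroidCoeff n rk) v d {none, none} *
        ((d + 1) * ((d + 2) * symEval (matroidCoeff n rk) v (d + 2) 0)) ≤
      ((d + 1) * symEval (matroidCoeff n rk) v (d + 1) {none}) ^ 2 := by
    intro v hv
    have := isHyperbolicAt_symHess matroidCoeff_nonneg h.matroidCoeff_of_cons
      (o := none) (fun s hs => by rwa [matroidCoeff_none_cons]) hv
      (h.isHyperbolicAt_symHess_zero fun i => (hv i).le) d 0 (by simpa using hd) (Pi.single none 1)
    rw [dotProduct_symHess_mulVec, single_one_dotProduct, single_one_dotProduct, symHess_mulVec,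
      mulVec_single_one] at this
    exact this
  have hcont : ∀ k s, Continuous fun ε : ℝ =>
      symEval (matroidCoeff n rk) (fun i => u i + ε) k s := fun k s =>
    (continuous_symEval _ k s).comp (by fun_prop)
  have hl : Continuous fun ε : ℝ => symEval (matroidCoeff n rk) (fun i => u i + ε) d {none, none} *
      ((d + 1) * ((d + 2) * symEval (matroidCoeff n rk) (fun i => u i + ε) (d + 2) 0)) :=
    (hcont _ _).mul (continuous_const.mul (continuous_const.mul (hcont _ _)))
  have hr : Continuous fun ε : ℝ =>
      ((d + 1) * symEval (matroidCoeff n rk) (fun i => u i + ε) (d + 1) {none}) ^ 2 :=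
    (continuous_const.mul (hcont _ _)).pow 2
  have hlim := le_of_tendsto_of_tendsto (b := nhdsWithin (0 : ℝ) (Set.Ioi 0))
    ((hl.tendsto 0).mono_left nhdsWithin_le_nhds) ((hr.tendsto 0).mono_left nhdsWithin_le_nhds)
    (Filter.eventually_of_mem self_mem_nhdsWithin fun ε hε =>
      hpos _ fun i => add_pos_of_nonneg_of_pos (hu i) hε)
  simpa only [add_zero] using hlim

end Matroid

theorem statement12 (n : ℕ) (hn : 2 ≤ n) (rk : Finset (Fin n) → ℕ)
    (hrk : IsMatroidRank n rk) (m : ℕ) (hm0 : 0 < m) (hmn : m < n)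
    (w : Fin n → ℝ) (hw : ∀ i, 0 ≤ w i) :
    (fm n rk (m+1) w / (n.choose (m+1) : ℝ)) * (fm n rk (m-1) w / (n.choose (m-1) : ℝ)) ≤
      (fm n rk m w) ^ 2 / ((n.choose m : ℝ)) ^ 2 := by
  obtain ⟨d, rfl⟩ : ∃ d, m = d + 1 := ⟨m - 1, by omega⟩
  obtain ⟨k, rfl⟩ : ∃ k, n = k + 1 + (d + 1) := ⟨n - (d + 1) - 1, by omega⟩
  have key := hrk.symEval_mul_le (d := d) (by omega) (u := fun i => i.elim 0 w)
    (by rintro (_ | i) <;> simp [hw])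
  rw [hrk.symEval_matroidCoeff_eq_fm rfl _ rfl, hrk.symEval_matroidCoeff_eq_fm rfl _ rfl,
    hrk.symEval_matroidCoeff_eq_fm rfl _ rfl] at key
  simp only [Option.elim] at key
  rw [show k + 1 + (d + 1) - d = k + 2 by omega, show k + 1 + (d + 1) - (d + 2) = k by omega,
    show k + 1 + (d + 1) - (d + 1) = k + 1 by omega] at key
  have hch : ∀ a b : ℕ, a + b = k + 1 + (d + 1) → (((k + 1 + (d + 1)).choose a : ℕ) : ℝ) =
      (k + 1 + (d + 1)).factorial / (a.factorial * b.factorial) := by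
    rintro a b hab
    rw [← hab, Nat.cast_add_choose]
  rw [Nat.add_sub_cancel, hch (d + 1 + 1) k (by omega), hch d (k + 2) (by omega),
    hch (d + 1) (k + 1) (by omega)]
  have hF : (0 : ℝ) < (k + 1 + (d + 1)).factorial := by positivity
  have hk : (0 : ℝ) < k.factorial := by positivity
  have hdf : (0 : ℝ) < d.factorial := by positivity
  generalize ((k + 1 + (d + 1)).factorial : ℝ) = F at hF ⊢
  simp only [Nat.factorial_succ, Nat.cast_mul, Nat.cast_add, Nat.cast_one] at key ⊢
  have hscale := mul_le_mul_of_nonneg_left key (by positivity : 0 ≤ (d.factorial : ℝ) ^ 2 / F ^ 2)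
  refine le_of_eq_of_le ?_ (hscale.trans_eq ?_)
  · field_simp
    ring
  · field_simp
end
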